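/- For each integer n ≥ 1 and each k' ∈ {0,4,6,8,10,14}, there exists a polynomial P_{n,k'}(X,Y) with integer coefficients such that for all ℓ ≥ 1 and 0 ≤ m ≤ ℓ with n ≤ ℓ − m, the sum of the n-th powers of the zeros (with multiplicity) of the Faber polynomial F_{12ℓ+k', m} equals P_{n,k'}(12ℓ + k', m). -/

import Mathlib

open Complex Polynomial Real MeasureTheory Filter Topology

noncomputable section

/-- `q = e^{2πiz}`. -/
def qexp (z : ℂ) : ℂ := Complex.exp (2 * Real.pi * Complex.I * z)

/-- The normalized Eisenstein series `E_k(z) = (1/2) ∑_{gcd(c,d)=1} (cz+d)^{-k}`,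
with the convention `E_0 = 1`. -/
def Eis (k : ℕ) (z : ℂ) : ℂ :=
  if k = 0 then 1
  else (1 / 2) * ∑' p : ℤ × ℤ, if Int.gcd p.1 p.2 = 1 then 1 / ((p.1 : ℂ) * z + (p.2 : ℂ)) ^ k else 0

/-- The modular discriminant `Δ(z) = q ∏_{n ≥ 1} (1 - q^n)^24`, `q = e^{2πiz}`. -/
def Disc (z : ℂ) : ℂ := qexp z * ∏' n : ℕ, (1 - qexp z ^ (n + 1)) ^ 24

/-- The modular `j`-invariant `j = E₄³ / Δ`. -/
def jinv (z : ℂ) : ℂ := Eis 4 z ^ 3 / Disc z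

/-- The coefficient of `q^d` in the Fourier/`q`-expansion of a `1`-periodic function
holomorphic on the upper half-plane, computed at height `1`. -/
def qCoeff (f : ℂ → ℂ) (d : ℤ) : ℂ :=
  ∫ x in (0:ℝ)..1,
    f (x + Complex.I) * Complex.exp (-(2 * Real.pi * Complex.I * d * (x + Complex.I)))

/-- `c_N(d)`: the coefficient of `q^d` in the Laurent expansion of `j^N`. -/
def cj (N : ℕ) (d : ℤ) : ℂ := qCoeff (fun z => jinv z ^ N) d

/-- `A_n = (1/2π) ∫_{π/2}^{2π/3} j(e^{iθ})^n dθ`. -/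
def Acoef (n : ℕ) : ℂ :=
  (1 / (2 * Real.pi)) *
    ∫ θ in (Real.pi / 2)..(2 * Real.pi / 3), jinv (Complex.exp (θ * Complex.I)) ^ n

/-- `B_n = -c_n(0)`, where `c_n(0)` is the coefficient of `q^0` in `j^n`. -/
def Bcoef (n : ℕ) : ℂ := - cj n 0

/-- `C_n(k') = 0` for `k' ∈ {0,4,8}` and `C_n(k') = -1728^n/2` for `k' ∈ {6,10,14}`. -/
def Ccoef (n k' : ℕ) : ℂ := if k' = 6 ∨ k' = 10 ∨ k' = 14 then -(1728 : ℂ) ^ n / 2 else 0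

/-- Real-valued version of `A_n` (recall `j` is real on the arc). -/
def AcoefR (n : ℕ) : ℝ :=
  (1 / (2 * Real.pi)) *
    ∫ θ in (Real.pi / 2)..(2 * Real.pi / 3), (jinv (Complex.exp (θ * Complex.I)) ^ n).re

/-- Real-valued version of `B_n = -c_n(0)` (recall `c_n(0)` is an integer). -/
def BcoefR (n : ℕ) : ℝ := - (cj n 0).re

/-- Real-valued version of `C_n(k')`. -/
def CcoefR (n k' : ℕ) : ℝ := if k' = 6 ∨ k' = 10 ∨ k' = 14 then -(1728 : ℝ) ^ n / 2 else 0

/-- `f` is the `m`-th element `f_{k,m} = q^m + O(q^{ℓ+1})` of the Miller basis of `M_k`,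
`k = 12ℓ + k'`: it is holomorphic on the upper half-plane, weight-`k` modular for
`SL₂(ℤ)`, and has a convergent `q`-expansion whose coefficients in degrees `≤ ℓ`
are `δ_{d,m}`. -/
def IsMillerForm (ℓ k' m : ℕ) (f : ℂ → ℂ) : Prop :=
  (∀ z : ℂ, 0 < z.im → DifferentiableAt ℂ f z) ∧
  (∀ z : ℂ, 0 < z.im → f (z + 1) = f z) ∧
  (∀ z : ℂ, 0 < z.im → f (-1 / z) = z ^ (12 * ℓ + k') * f z) ∧
  (∃ a : ℕ → ℂ,
    (∀ z : ℂ, 0 < z.im →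
      Summable (fun n : ℕ => a n * qexp z ^ n) ∧ f z = ∑' n : ℕ, a n * qexp z ^ n) ∧
    (∀ d : ℕ, d ≤ ℓ → a d = if d = m then 1 else 0))

/-- `F` is the Faber polynomial of `f = f_{k,m}`, `k = 12ℓ + k'`: the monic polynomial
of degree `ℓ - m` with `f = Δ^ℓ ⬝ E_{k'} ⬝ F(j)`. -/
def IsFaber (ℓ k' m : ℕ) (f : ℂ → ℂ) (F : Polynomial ℂ) : Prop :=
  F.Monic ∧ F.natDegree = ℓ - m ∧
  ∀ z : ℂ, 0 < z.im → f z = Disc z ^ ℓ * Eis k' z * F.eval (jinv z)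

/-- The sum of the `n`-th powers of the zeros of `F`, counted with multiplicity. -/
def powerSumRoots (F : Polynomial ℂ) (n : ℕ) : ℂ := (F.roots.map (fun x => x ^ n)).sum

/-- The (finite) solutions of `d_1 + 2 d_2 + ⋯ + n d_n = n` in nonnegative integers,
indexed by `Fin n` (so index `t : Fin n` stands for `d_{t+1}`).  Note any solution
automatically has `d_t ≤ n`. -/
def sols (n : ℕ) : Finset (Fin n → ℕ) :=
  (Fintype.piFinset fun _ : Fin n => Finset.range (n + 1)).filter
    (fun d => ∑ t : Fin n, ((t : ℕ) + 1) * d t = n)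


section FormalPart

/-- `l` is the logarithmic derivative `X g' / g` of `g`. -/
def IsL {R : Type*} [CommRing R] (g l : PowerSeries R) : Prop :=
  PowerSeries.X * PowerSeries.derivative R g = l * g

lemma IsL.mul {R : Type*} [CommRing R] {g l h l' : PowerSeries R} (h1 : IsL g l) (h2 : IsL h l') :
    IsL (g * h) (l + l') := by
  unfold IsL at *
  rw [Derivation.leibniz, smul_eq_mul, smul_eq_mul]
  linear_combination h * h1 + g * h2

lemma IsL.one {R : Type*} [CommRing R] : IsL (1 : PowerSeries R) 0 := by
  unfold IsL
  simp

lemma IsL.X {R : Type*} [CommRing R] : IsL (PowerSeries.X : PowerSeries R) 1 := by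
  simp [IsL]

lemma IsL.pow {R : Type*} [CommRing R] {g l : PowerSeries R} (h1 : IsL g l) (n : ℕ) :
    IsL (g ^ n) (n * l) := by
  induction n with
  | zero => simpa using IsL.one
  | succ n ih =>
    rw [pow_succ]
    have := ih.mul h1
    convert this using 1
    push_cast
    ring

lemma IsL.map {R S : Type*} [CommRing R] [CommRing S] (φ : R →+* S) {g l : PowerSeries R}
    (h1 : IsL g l) : IsL (PowerSeries.map φ g) (PowerSeries.map φ l) := by
  unfold IsL at *
  have h2 := congrArg (PowerSeries.map φ) h1
  rw [map_mul, map_mul, PowerSeries.map_X] at h2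
  rw [← h2]
  congr 1
  ext n
  simp [PowerSeries.coeff_derivative]

lemma IsL.multiset_prod {R ι : Type*} [CommRing R] (s : Multiset ι) (g l : ι → PowerSeries R)
    (h : ∀ i, IsL (g i) (l i)) : IsL (s.map g).prod (s.map l).sum := by
  induction s using Multiset.induction_on with
  | empty => simpa using IsL.one
  | cons a s ih =>
    simp only [Multiset.map_cons, Multiset.prod_cons, Multiset.sum_cons]
    exact (h a).mul ih

/-- a power series with constant coefficient one has an inverse -/
lemma exists_inv {R : Type*} [CommRing R] (g : PowerSeries R)
    (hg : PowerSeries.constantCoeff g = 1) :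
    ∃ h : PowerSeries R, g * h = 1 ∧ PowerSeries.constantCoeff h = 1 := by
  have h1 := PowerSeries.mul_invOfUnit g 1 (by simpa using hg)
  refine ⟨_, h1, ?_⟩
  have := congrArg PowerSeries.constantCoeff h1
  simpa [hg] using this

lemma exists_IsL {R : Type*} [CommRing R] (g : PowerSeries R)
    (hg : PowerSeries.constantCoeff g = 1) :
    ∃ l : PowerSeries R, IsL g l ∧ PowerSeries.constantCoeff l = 0 := by
  obtain ⟨h, hh, -⟩ := exists_inv g hg
  refine ⟨PowerSeries.X * PowerSeries.derivative R g * h, ?_, by simp⟩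
  unfold IsL
  linear_combination (-PowerSeries.X * PowerSeries.derivative R g) * hh

lemma IsL.unique {g l l' : PowerSeries ℂ} (hg : g ≠ 0) (h1 : IsL g l) (h2 : IsL g l') : l = l' := by
  unfold IsL at *
  exact mul_right_cancel₀ hg (h1.symm.trans h2)

lemma IsL.dvd {l B : PowerSeries ℂ} {N : ℕ} (hN : 1 ≤ N)
    (h : IsL (1 + PowerSeries.X ^ N * B) l) : (PowerSeries.X : PowerSeries ℂ) ^ N ∣ l := by
  have hc : PowerSeries.constantCoeff (1 + PowerSeries.X ^ N * B) = 1 := by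
    simp [show N ≠ 0 by omega]
  obtain ⟨g, hg, -⟩ := exists_inv _ hc
  have h2 : PowerSeries.X * PowerSeries.derivative ℂ (1 + PowerSeries.X ^ N * B)
      = PowerSeries.X ^ N * ((N : PowerSeries ℂ) * B + PowerSeries.X * PowerSeries.derivative ℂ B) := by
    have h3 : IsL ((PowerSeries.X : PowerSeries ℂ) ^ N) (N * 1) := IsL.X.pow N
    unfold IsL at h3
    rw [map_add, Derivation.leibniz, smul_eq_mul, smul_eq_mul,
      Derivation.map_one_eq_zero]
    linear_combination B * h3
  unfold IsL at h
  refine ⟨((N : PowerSeries ℂ) * B + PowerSeries.X * PowerSeries.derivative ℂ B) * g, ?_⟩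
  linear_combination (-l) * hg - g * h + g * h2

/-- The formal heart of the proof. -/
lemma formal_main (d e : PowerSeries ℤ) (s : PowerSeries ℤ)
    (hd : PowerSeries.constantCoeff d = 1) (he : PowerSeries.constantCoeff e = 1)
    (hs : PowerSeries.constantCoeff s = 0) (k' : ℕ) (n : ℕ) (hn : 1 ≤ n) :
    ∃ P : MvPolynomial (Fin 2) ℤ, ∀ (ℓ m : ℕ), m ≤ ℓ → n ≤ ℓ - m →
      ∀ (r : Multiset ℂ) (B : PowerSeries ℂ), r.card = ℓ - m →
      PowerSeries.map (Int.castRingHom ℂ) d ^ m * PowerSeries.map (Int.castRingHom ℂ) e *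
        (r.map (fun x => PowerSeries.map (Int.castRingHom ℂ) (1 + 240 * s) ^ 3
          - PowerSeries.C x * (PowerSeries.X * PowerSeries.map (Int.castRingHom ℂ) d))).prod
        = 1 + PowerSeries.X ^ (ℓ - m + 1) * B →
      (r.map (fun x => x ^ n)).sum
        = MvPolynomial.aeval ![((12 * ℓ + k' : ℕ) : ℂ), (m : ℂ)] P := by
  induction n using Nat.strong_induction_on with
  | _ n ih =>
  have hE : PowerSeries.constantCoeff (1 + 240 * s) = 1 := by simp [hs]
  obtain ⟨v0, hv0, hv0c⟩ := exists_inv _ hE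
  obtain ⟨ld, hld, hldc⟩ := exists_IsL d hd
  obtain ⟨le, hle, hlec⟩ := exists_IsL e he
  obtain ⟨t, ht⟩ : ∃ t, t = PowerSeries.X * PowerSeries.derivative ℤ s * v0 := ⟨_, rfl⟩
  have hlE : IsL (1 + 240 * s) (240 * t) := by
    unfold IsL
    have : PowerSeries.derivative ℤ (1 + 240 * s) = 240 * PowerSeries.derivative ℤ s := by
      have h240 : PowerSeries.derivative ℤ (240 : PowerSeries ℤ) = 0 := by
        exact_mod_cast (PowerSeries.derivative ℤ).map_natCast 240
      rw [map_add, Derivation.leibniz, smul_eq_mul, smul_eq_mul, h240,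
        Derivation.map_one_eq_zero]
      ring
    rw [this, ht]
    linear_combination (-240 * PowerSeries.X * PowerSeries.derivative ℤ s) * hv0
  have htc : PowerSeries.constantCoeff t = 0 := by simp [ht]
  -- the series `w = X u'/u` and `u1 = u / X`
  obtain ⟨w, hw⟩ : ∃ w, w = 1 + ld - 720 * t := ⟨_, rfl⟩
  obtain ⟨u1, hu1⟩ : ∃ u1, u1 = d * v0 ^ 3 := ⟨_, rfl⟩
  have hwc : PowerSeries.constantCoeff w = 1 := by simp [hw, hldc, htc]
  have hu1c : PowerSeries.constantCoeff u1 = 1 := by simp [hu1, hd, hv0c]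
  have hlv0 : IsL v0 (-240 * t) := by
    unfold IsL at *
    have h1 := congrArg (PowerSeries.derivative ℤ) hv0
    rw [Derivation.leibniz, smul_eq_mul, smul_eq_mul, Derivation.map_one_eq_zero] at h1
    linear_combination (-PowerSeries.X * PowerSeries.derivative ℤ v0 - 240 * t * v0) * hv0
      + PowerSeries.X * v0 * h1 - v0 ^ 2 * hlE
  have hlu : IsL (PowerSeries.X * u1) w := by
    have := IsL.X.mul (hld.mul (hlv0.pow 3))
    rw [hu1, hw]
    convert this using 1
    push_cast
    ring
  -- choose the lower polynomials
  have ih' : ∀ i : ℕ, ∃ P : MvPolynomial (Fin 2) ℤ, i < n → 1 ≤ i → ∀ (ℓ m : ℕ), m ≤ ℓ →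
      i ≤ ℓ - m →
      ∀ (r : Multiset ℂ) (B : PowerSeries ℂ), r.card = ℓ - m →
      PowerSeries.map (Int.castRingHom ℂ) d ^ m * PowerSeries.map (Int.castRingHom ℂ) e *
        (r.map (fun x => PowerSeries.map (Int.castRingHom ℂ) (1 + 240 * s) ^ 3
          - PowerSeries.C x * (PowerSeries.X * PowerSeries.map (Int.castRingHom ℂ) d))).prod
        = 1 + PowerSeries.X ^ (ℓ - m + 1) * B →
      (r.map (fun x => x ^ i)).sum
        = MvPolynomial.aeval ![((12 * ℓ + k' : ℕ) : ℂ), (m : ℂ)] P := by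
    intro i
    by_cases hi : i < n ∧ 1 ≤ i
    · obtain ⟨P, hP⟩ := ih i hi.1 hi.2
      exact ⟨P, fun _ _ => hP⟩
    · exact ⟨0, fun h1 h2 => absurd ⟨h1, h2⟩ hi⟩
  choose Q hQ using ih'
  refine ⟨MvPolynomial.X 1 * MvPolynomial.C (PowerSeries.coeff n ld)
    + MvPolynomial.C (PowerSeries.coeff n le)
    + (60 * (MvPolynomial.X 0 - MvPolynomial.C (k' : ℤ)) - 720 * MvPolynomial.X 1) *
      MvPolynomial.C (PowerSeries.coeff n t)
    - ∑ i ∈ Finset.Ico 1 n, MvPolynomial.C (PowerSeries.coeff n (w * (PowerSeries.X * u1) ^ i))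
        * Q i, ?_⟩
  intro ℓ m hmℓ hnD r B hr hprod
  set φ := PowerSeries.map (Int.castRingHom ℂ) with hφ
  have hφX : φ PowerSeries.X = PowerSeries.X := PowerSeries.map_X _
  -- logarithmic derivatives of factors
  have hfac : ∀ x : ℂ, ∃ y : PowerSeries ℂ,
      IsL (φ (1 + 240 * s) ^ 3 - PowerSeries.C x * (PowerSeries.X * φ d))
      (720 * φ t - φ w * ∑ i ∈ Finset.Ico 1 (n + 1), PowerSeries.C (x ^ i) *
        (PowerSeries.X * φ u1) ^ i + PowerSeries.X ^ (n + 1) * y) := by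
    intro x
    obtain ⟨h, hh, -⟩ := exists_inv (1 - PowerSeries.C x * (PowerSeries.X * φ u1)) (by simp)
    refine ⟨- φ w * h * (PowerSeries.C x * φ u1) ^ (n + 1), ?_⟩
    have e1 : φ (1 + 240 * s) ^ 3 - PowerSeries.C x * (PowerSeries.X * φ d)
        = φ (1 + 240 * s) ^ 3 * (1 - PowerSeries.C x * (PowerSeries.X * φ u1)) := by
      have h3 : φ (1 + 240 * s) ^ 3 * φ v0 ^ 3 = 1 := by
        rw [← mul_pow, ← map_mul, hv0, map_one, one_pow]
      rw [hu1, map_mul, map_pow]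
      linear_combination (PowerSeries.C x * (PowerSeries.X * φ d)) * h3
    have e2 : IsL (φ (1 + 240 * s) ^ 3) (720 * φ t) := by
      have := (hlE.map (Int.castRingHom ℂ)).pow 3
      convert this using 1
      rw [map_mul, ← hφ, show φ (240 : PowerSeries ℤ) = 240 by exact map_ofNat φ 240]
      push_cast
      ring
    have e3 : IsL (PowerSeries.X * φ u1) (φ w) := by
      have := hlu.map (Int.castRingHom ℂ)
      rw [map_mul, ← hφ, hφX] at this
      exact this
    have geo : ∀ a b : PowerSeries ℂ, (1 - a) * b = 1 → ∀ N : ℕ,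
        a * b = ∑ i ∈ Finset.Ico 1 (N + 1), a ^ i + b * a ^ (N + 1) := by
      intro a b hab N
      induction N with
      | zero => simp; ring
      | succ N ihN =>
        rw [Finset.sum_Ico_succ_top (by omega), ihN]
        linear_combination (a ^ (N + 1)) * hab
    have e4 : IsL (1 - PowerSeries.C x * (PowerSeries.X * φ u1))
        (- φ w * ((PowerSeries.C x * (PowerSeries.X * φ u1)) * h)) := by
      unfold IsL at *
      have hC : PowerSeries.derivative ℂ (PowerSeries.C x) = 0 := PowerSeries.derivative_C
      rw [map_sub, Derivation.map_one_eq_zero, Derivation.leibniz, smul_eq_mul, smul_eq_mul, hC]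
      linear_combination (-PowerSeries.C x) * e3
        + (φ w * (PowerSeries.C x * (PowerSeries.X * φ u1))) * hh
    rw [e1]
    have e5 := e2.mul e4
    rw [geo _ _ hh n] at e5
    convert e5 using 1
    simp only [mul_pow, map_pow]
    ring
  choose y hy using hfac
  have hL := ((hld.map (Int.castRingHom ℂ)).pow m).mul (hle.map (Int.castRingHom ℂ)) |>.mul
    (IsL.multiset_prod r _ _ hy)
  rw [← hφ, hprod] at hL
  have hdvd := hL.dvd (by omega)
  have hdvd2 : (PowerSeries.X : PowerSeries ℂ) ^ (n + 1) ∣ _ :=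
    (pow_dvd_pow _ (by omega)).trans hdvd
  have hcoef := (PowerSeries.X_pow_dvd_iff.mp hdvd2) n (by omega)
  have hsum : (r.map (fun x => 720 * φ t - φ w * ∑ i ∈ Finset.Ico 1 (n + 1), PowerSeries.C (x ^ i) *
        (PowerSeries.X * φ u1) ^ i + PowerSeries.X ^ (n + 1) * y x)).sum
      = ((r.card : ℕ) : PowerSeries ℂ) * (720 * φ t) - ∑ i ∈ Finset.Ico 1 (n + 1),
        PowerSeries.C ((r.map (fun x => x ^ i)).sum) * φ (w * (PowerSeries.X * u1) ^ i)
        + PowerSeries.X ^ (n + 1) * (r.map y).sum := by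
    clear hr hprod hL hdvd hdvd2 hcoef
    induction r using Multiset.induction_on with
    | empty => simp
    | cons a r ihr =>
      simp only [Multiset.map_cons, Multiset.sum_cons, Multiset.card_cons] at ihr ⊢
      rw [ihr]
      simp only [map_add, add_mul, Finset.sum_add_distrib, map_mul, map_pow, hφX, Finset.mul_sum]
      have : ∀ i, φ w * (PowerSeries.C a ^ i * (PowerSeries.X * φ u1) ^ i) =
        PowerSeries.C a ^ i * (φ w * (PowerSeries.X * φ u1) ^ i) := fun i => by ring
      simp only [this]
      push_cast
      ring
  rw [hsum, hr] at hcoef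
  have hlead : PowerSeries.coeff n (w * (PowerSeries.X * u1) ^ n) = 1 := by
    rw [mul_pow, mul_left_comm, PowerSeries.coeff_X_pow_mul']
    simp [hwc, hu1c]
  have hcm : ∀ g : PowerSeries ℤ, PowerSeries.coeff n (φ g) = ((PowerSeries.coeff n g : ℤ) : ℂ) := by
    intro g
    simp [hφ]
  have hnat : ∀ (a : ℕ) (g : PowerSeries ℂ), PowerSeries.coeff n ((a : PowerSeries ℂ) * g)
      = a * PowerSeries.coeff n g := by
    intro a g
    rw [← nsmul_eq_mul, map_nsmul, nsmul_eq_mul]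
  rw [Finset.sum_Ico_succ_top hn] at hcoef
  have h720 : PowerSeries.coeff n (720 * φ t) = 720 * ((PowerSeries.coeff n t : ℤ) : ℂ) := by
    have := hnat 720 (φ t)
    rw [hcm] at this
    exact_mod_cast this
  have hXn : PowerSeries.coeff n (PowerSeries.X ^ (n + 1) * (r.map y).sum) = 0 := by
    rw [PowerSeries.coeff_X_pow_mul']
    simp
  simp only [map_add, map_sub, map_sum, PowerSeries.coeff_C_mul, hnat, hcm, hXn, h720, hlead]
    at hcoef
  have hlow : ∀ i ∈ Finset.Ico 1 n, (r.map (fun x => x ^ i)).sum *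
      ((PowerSeries.coeff n (w * (PowerSeries.X * u1) ^ i) : ℤ) : ℂ)
      = ((PowerSeries.coeff n (w * (PowerSeries.X * u1) ^ i) : ℤ) : ℂ) *
        MvPolynomial.aeval ![((12 * ℓ + k' : ℕ) : ℂ), (m : ℂ)] (Q i) := by
    intro i hi
    rw [Finset.mem_Ico] at hi
    rw [hQ i hi.2 hi.1 ℓ m hmℓ (by omega) r B hr hprod]
    ring
  rw [Finset.sum_congr rfl hlow] at hcoef
  have hcast : ((ℓ - m : ℕ) : ℂ) = (ℓ : ℂ) - m := by
    push_cast [hmℓ]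
    ring
  rw [hcast] at hcoef
  simp only [map_add, map_sub, map_mul, map_sum, MvPolynomial.aeval_X, MvPolynomial.aeval_C,
    map_ofNat]
  simp
  simp at hcoef
  linear_combination -hcoef

end FormalPart

section AnalyticPart

/-- the power series `φ` evaluated at `q` converges to `c` -/
def HS (φ : PowerSeries ℂ) (q c : ℂ) : Prop :=
  HasSum (fun n : ℕ => PowerSeries.coeff n φ * q ^ n) c

lemma HS.mul {φ ψ : PowerSeries ℂ} {q a b : ℂ} (h1 : HS φ q a) (h2 : HS ψ q b) :
    HS (φ * ψ) q (a * b) := by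
  unfold HS at *
  have := hasSum_sum_range_mul_of_summable_norm h1.summable.norm h2.summable.norm
  rw [h1.tsum_eq, h2.tsum_eq] at this
  convert! this using 1
  funext n
  rw [PowerSeries.coeff_mul, Finset.Nat.sum_antidiagonal_eq_sum_range_succ_mk, Finset.sum_mul]
  refine Finset.sum_congr rfl fun k hk => ?_
  have hk' : k + (n - k) = n := by
    have := Finset.mem_range.mp hk
    omega
  rw [← congrArg (fun t => q ^ t) hk']
  simp only [pow_add]
  ring

lemma HS.C (x q : ℂ) : HS (PowerSeries.C x) q x := by
  unfold HS
  convert hasSum_single (f := fun n : ℕ => PowerSeries.coeff n (PowerSeries.C x) * q ^ n) 0 ?_ using 1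
  · simp
  · intro n hn
    simp [PowerSeries.coeff_C, hn]

lemma HS.one (q : ℂ) : HS 1 q 1 := by
  simpa using HS.C 1 q

lemma HS.X (q : ℂ) : HS PowerSeries.X q q := by
  unfold HS
  convert hasSum_single (f := fun n : ℕ => PowerSeries.coeff n (PowerSeries.X) * q ^ n) 1 ?_ using 1
  · simp
  · intro n hn
    simp [PowerSeries.coeff_X, hn]

lemma HS.sub {φ ψ : PowerSeries ℂ} {q a b : ℂ} (h1 : HS φ q a) (h2 : HS ψ q b) :
    HS (φ - ψ) q (a - b) := by
  unfold HS at *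
  convert! HasSum.sub h1 h2 using 1
  funext n
  rw [map_sub]
  ring

lemma HS.pow {φ : PowerSeries ℂ} {q a : ℂ} (h1 : HS φ q a) (n : ℕ) :
    HS (φ ^ n) q (a ^ n) := by
  induction n with
  | zero => simpa using HS.one q
  | succ n ih =>
    rw [pow_succ, pow_succ]
    exact ih.mul h1

lemma HS.multiset_prod {ι : Type*} (s : Multiset ι) (g : ι → PowerSeries ℂ) (c : ι → ℂ) (q : ℂ)
    (h : ∀ i, HS (g i) q (c i)) : HS (s.map g).prod q (s.map c).prod := by
  induction s using Multiset.induction_on with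
  | empty => simpa using HS.one q
  | cons a s ih =>
    simp only [Multiset.map_cons, Multiset.prod_cons]
    exact (h a).mul ih

lemma HS.of_X_pow_mul {φ : PowerSeries ℂ} {q : ℂ} (hq : q ≠ 0) (N : ℕ)
    (h : HS (PowerSeries.X ^ N * φ) q 0) : HS φ q 0 := by
  unfold HS at *
  rw [← hasSum_nat_add_iff' N] at h
  have h0 : ∑ i ∈ Finset.range N, PowerSeries.coeff i (PowerSeries.X ^ N * φ) * q ^ i = 0 := by
    refine Finset.sum_eq_zero fun i hi => ?_
    rw [PowerSeries.coeff_X_pow_mul', if_neg (by simpa using hi), zero_mul]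
  rw [h0, sub_zero] at h
  have h2 := h.mul_left ((q ^ N)⁻¹)
  rw [mul_zero] at h2
  convert! h2 using 1
  funext n
  rw [PowerSeries.coeff_X_pow_mul, pow_add]
  field_simp

lemma qexp_ne_zero (z : ℂ) : qexp z ≠ 0 := Complex.exp_ne_zero _

lemma norm_qexp_lt_one {z : ℂ} (hz : 0 < z.im) : ‖qexp z‖ < 1 := by
  have := UpperHalfPlane.norm_exp_two_pi_I_lt_one ⟨z, hz⟩
  exact this

lemma HS.constantCoeff_eq_zero {φ : PowerSeries ℂ}
    (h : ∀ z : ℂ, 0 < z.im → HS φ (qexp z) 0) : PowerSeries.coeff 0 φ = 0 := by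
  set z : ℕ → ℂ := fun j => ((j + 1 : ℕ) : ℂ) * Complex.I with hz
  have hzim : ∀ j, 0 < (z j).im := by
    intro j
    simp [hz]
    positivity
  have hq : ∀ j, qexp (z j) = qexp Complex.I ^ (j + 1) := by
    intro j
    simp only [qexp, hz]
    rw [← Complex.exp_nat_mul]
    congr 1
    ring
  have hI : ‖qexp Complex.I‖ < 1 := norm_qexp_lt_one (by simp)
  have hlim : Tendsto (fun j => qexp (z j)) atTop (𝓝 0) := by
    simp only [hq]
    exact (tendsto_pow_atTop_nhds_zero_of_norm_lt_one hI).comp (tendsto_add_atTop_nat 1)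
  have key := tendsto_tsum_of_dominated_convergence (𝓕 := atTop)
    (f := fun (j : ℕ) (n : ℕ) => PowerSeries.coeff n φ * qexp (z j) ^ n)
    (g := fun n => PowerSeries.coeff n φ * 0 ^ n)
    (bound := fun n => ‖PowerSeries.coeff n φ * qexp Complex.I ^ n‖)
    ((h Complex.I (by simp)).summable.norm)
    (fun n => (hlim.pow n).const_mul _)
    (Eventually.of_forall fun j n => by
      rw [norm_mul, norm_mul, norm_pow, norm_pow, hq, norm_pow]
      gcongr
      exact pow_le_of_le_one (norm_nonneg _) hI.le (by omega))
  have h0 : (fun j => ∑' n, PowerSeries.coeff n φ * qexp (z j) ^ n) = fun _ => 0 := by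
    funext j
    exact (h (z j) (hzim j)).tsum_eq
  rw [h0] at key
  have h1 : ∑' n, PowerSeries.coeff n φ * (0:ℂ) ^ n = PowerSeries.coeff 0 φ := by
    rw [tsum_eq_single 0]
    · simp
    · intro n hn
      simp [hn]
  rw [h1] at key
  exact (tendsto_nhds_unique key tendsto_const_nhds)

lemma HS.eq_zero {φ : PowerSeries ℂ}
    (h : ∀ z : ℂ, 0 < z.im → HS φ (qexp z) 0) : φ = 0 := by
  have hN : ∀ N : ℕ, (PowerSeries.X : PowerSeries ℂ) ^ N ∣ φ := by
    intro N
    induction N with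
    | zero => simp
    | succ N ih =>
      obtain ⟨ψ, rfl⟩ := ih
      have h1 : PowerSeries.coeff 0 ψ = 0 :=
        HS.constantCoeff_eq_zero fun z hz => (h z hz).of_X_pow_mul (qexp_ne_zero z) N
      rw [pow_succ]
      exact mul_dvd_mul_left _ (PowerSeries.X_dvd_iff.mpr (by simpa using h1))
  ext n
  exact PowerSeries.X_pow_dvd_iff.mp (hN (n + 1)) n (by omega)

lemma HS.unique {φ ψ : PowerSeries ℂ} {g : ℂ → ℂ}
    (h : ∀ z : ℂ, 0 < z.im → HS φ (qexp z) (g z))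
    (h' : ∀ z : ℂ, 0 < z.im → HS ψ (qexp z) (g z)) : φ = ψ := by
  rw [← sub_eq_zero]
  refine HS.eq_zero fun z hz => ?_
  have := (h z hz).sub (h' z hz)
  rwa [sub_self] at this

/-- iterated derivatives of a locally uniform limit -/
lemma tendsto_iteratedDeriv {ι : Type*} {l : Filter ι} {F : ι → ℂ → ℂ} {f : ℂ → ℂ} {U : Set ℂ}
    (hU : IsOpen U) (hF : ∀ i, Differentiable ℂ (F i)) (h : TendstoLocallyUniformlyOn F f l U)
    (n : ℕ) : TendstoLocallyUniformlyOn (fun i => iteratedDeriv n (F i)) (iteratedDeriv n f) l U := by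
  induction n with
  | zero => simpa using h
  | succ n ih =>
    simp only [iteratedDeriv_succ]
    refine ih.deriv (Eventually.of_forall fun i => ?_) hU
    exact ((hF i).contDiff (n := ⊤).differentiable_iteratedDeriv n
      (by exact_mod_cast WithTop.coe_lt_top _)).differentiableOn

lemma iteratedDeriv_poly (p : Polynomial ℂ) (n : ℕ) :
    iteratedDeriv n (fun x => p.eval x) 0 = (n.factorial : ℂ) * p.coeff n := by
  have h : ∀ (n : ℕ) (p : Polynomial ℂ), iteratedDeriv n (fun x => p.eval x) =
      fun x => (Polynomial.derivative^[n] p).eval x := by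
    intro n
    induction n with
    | zero => intro p; simp
    | succ n ih =>
      intro p
      rw [iteratedDeriv_succ, ih]
      funext x
      rw [Polynomial.deriv, Function.iterate_succ_apply']
  rw [h]
  simp only [← Polynomial.coeff_zero_eq_eval_zero]
  rw [Polynomial.coeff_iterate_derivative]
  simp [Nat.descFactorial_self]

lemma HS_euler {q : ℂ} (hq : ‖q‖ < 1) :
    HS (PowerSeries.pentagonalSeries ℂ) q (∏' n : ℕ, (1 - q ^ (n + 1))) := by
  set G : ℂ → ℂ := fun q => ∏' n : ℕ, (1 - q ^ (n + 1)) with hG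
  have hlu := ModularForm.multipliableLocallyUniformlyOn_one_sub_pow.hasProdLocallyUniformlyOn
  set p : Finset ℕ → Polynomial ℂ := fun s => ∏ n ∈ s, (1 - Polynomial.X ^ (n + 1)) with hp
  have hlu2 : TendstoLocallyUniformlyOn (fun s x => (p s).eval x) G atTop (Metric.ball (0:ℂ) 1) := by
    have h1 := hlu
    unfold HasProdLocallyUniformlyOn at h1
    convert h1 using 1
    funext s x
    simp [hp, Polynomial.eval_prod]
  have hcoef : ∀ n, iteratedDeriv n G 0 = (n.factorial : ℂ) *
      PowerSeries.coeff n (PowerSeries.pentagonalSeries ℂ) := by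
    intro n
    have h1 := (tendsto_iteratedDeriv Metric.isOpen_ball (fun s => (p s).differentiable) hlu2 n).tendsto_at
      (Metric.mem_ball_self one_pos)
    refine tendsto_nhds_unique h1 ?_
    refine tendsto_nhds_of_eventually_eq ?_
    filter_upwards [PowerSeries.coeff_prod_one_sub_X_pow_eventually_eq ℂ n] with s hs
    rw [iteratedDeriv_poly, ← hs, ← Polynomial.coeff_coe]
    congr 2
    simp only [hp]
    rw [← Polynomial.coeToPowerSeries.ringHom_apply, map_prod]
    simp
  have h2 := Complex.hasSum_taylorSeries_on_ball (c := 0) (r := 1) (z := q) (f := G)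
    (by simpa using ModularForm.differentiableOn_tprod_one_sub_pow) (by simpa using hq)
  unfold HS
  convert! h2 using 1
  funext n
  rw [hcoef, smul_eq_mul, smul_eq_mul, sub_zero]
  have : (n.factorial : ℂ) ≠ 0 := by exact_mod_cast n.factorial_ne_zero
  field_simp

lemma map_pent : PowerSeries.map (Int.castRingHom ℂ) (PowerSeries.pentagonalSeries ℤ)
    = PowerSeries.pentagonalSeries ℂ := by
  ext n
  by_cases h : n ∈ Set.range pentagonal
  · obtain ⟨k, rfl⟩ := h
    simp
  · simp [PowerSeries.coeff_pentagonalSeries_eq_zero _ h]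

lemma pent_const : PowerSeries.constantCoeff (PowerSeries.pentagonalSeries ℤ) = 1 := by
  have := PowerSeries.coeff_pentagonalSeries_pentagonal ℤ 0
  rw [← PowerSeries.coeff_zero_eq_constantCoeff_apply]
  exact this

lemma HS_disc {z : ℂ} (hz : 0 < z.im) :
    HS (PowerSeries.X * PowerSeries.map (Int.castRingHom ℂ) (PowerSeries.pentagonalSeries ℤ ^ 24))
      (qexp z) (Disc z) := by
  unfold Disc
  have hq := norm_qexp_lt_one hz
  rw [(ModularForm.multipliable_one_sub_pow hq).tprod_pow 24, map_pow, map_pent]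
  exact (HS.X _).mul ((HS_euler hq).pow 24)

lemma Disc_ne_zero {z : ℂ} (hz : 0 < z.im) : Disc z ≠ 0 := by
  unfold Disc
  have hq := norm_qexp_lt_one hz
  rw [(ModularForm.multipliable_one_sub_pow hq).tprod_pow 24]
  refine mul_ne_zero (qexp_ne_zero z) (pow_ne_zero _ ?_)
  have := ModularForm.eta_tprod_ne_zero (z := z) hz
  simp only [ModularForm.eta_q_eq_pow] at this
  exact this

lemma Eis_eq {k : ℕ} (hk : 3 ≤ k) {z : ℂ} (hz : 0 < z.im) :
    Eis k z = ModularForm.E hk ⟨z, hz⟩ := by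
  classical
  unfold Eis
  rw [if_neg (by omega)]
  have h : ModularForm.E hk ⟨z, hz⟩ = (1 / 2 : ℂ) * eisensteinSeries (N := 1) 0 k ⟨z, hz⟩ := rfl
  rw [h]
  congr 1
  unfold eisensteinSeries
  rw [tsum_subtype (EisensteinSeries.gammaSet 1 1 0) (fun v => EisensteinSeries.eisSummand k v ⟨z, hz⟩),
    ← (finTwoArrowEquiv ℤ).tsum_eq]
  refine tsum_congr fun v => ?_
  rw [Set.indicator_apply]
  simp only [EisensteinSeries.gammaSet_one_mem_iff, finTwoArrowEquiv_apply,
    EisensteinSeries.eisSummand]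
  simp

open scoped ArithmeticFunction.sigma in
lemma HS_Eis {k : ℕ} (hk : 3 ≤ k) (hk2 : Even k) (c : ℤ) (hc : -(2 * k / _root_.bernoulli k : ℚ) = c)
    {z : ℂ} (hz : 0 < z.im) :
    HS (PowerSeries.map (Int.castRingHom ℂ)
      (1 + (c : PowerSeries ℤ) * PowerSeries.mk fun n => if n = 0 then 0 else ((ArithmeticFunction.sigma (k - 1) n : ℕ) : ℤ)))
      (qexp z) (Eis k z) := by
  have hc' : -(2 * k / _root_.bernoulli k : ℂ) = c := by exact_mod_cast congrArg (fun x : ℚ => (x : ℂ)) hc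
  rw [Eis_eq hk hz]
  have h := ModularForm.hasSum_qExpansion (ModularForm.E hk) one_pos
    (by simp) ⟨z, hz⟩
  unfold HS
  convert! h using 1
  funext n
  rw [EisensteinSeries.E_qExpansion_coeff hk hk2, hc']
  have hCc : (c : PowerSeries ℤ) = PowerSeries.C c := (map_intCast (PowerSeries.C (R := ℤ)) c).symm
  rw [hCc, PowerSeries.coeff_map, map_add, PowerSeries.coeff_C_mul, PowerSeries.coeff_mk,
    PowerSeries.coeff_one]
  by_cases hn : n = 0
  · simp [hn]
  · simp [hn, qexp, Function.Periodic.qParam, PowerSeries.coeff_one]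

lemma bern_vals : _root_.bernoulli 4 = -1/30 ∧ _root_.bernoulli 6 = 1/42 ∧ _root_.bernoulli 8 = -1/30 ∧
    _root_.bernoulli 10 = 5/66 ∧ _root_.bernoulli 14 = 7/6 := by
  have h5 : bernoulli' 5 = 0 := bernoulli'_eq_zero_of_odd (by decide) (by norm_num)
  have h7 : bernoulli' 7 = 0 := bernoulli'_eq_zero_of_odd (by decide) (by norm_num)
  have h9 : bernoulli' 9 = 0 := bernoulli'_eq_zero_of_odd (by decide) (by norm_num)
  have h11 : bernoulli' 11 = 0 := bernoulli'_eq_zero_of_odd (by decide) (by norm_num)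
  have h13 : bernoulli' 13 = 0 := bernoulli'_eq_zero_of_odd (by decide) (by norm_num)
  have h6 : bernoulli' 6 = 1/42 := by
    rw [bernoulli'_def]
    norm_num [Finset.sum_range_succ, Nat.choose, h5]
  have h8 : bernoulli' 8 = -1/30 := by
    rw [bernoulli'_def]
    norm_num [Finset.sum_range_succ, Nat.choose, h5, h6, h7]
  have h10 : bernoulli' 10 = 5/66 := by
    rw [bernoulli'_def]
    norm_num [Finset.sum_range_succ, Nat.choose, h5, h6, h7, h8, h9]
  have h12 : bernoulli' 12 = -691/2730 := by
    rw [bernoulli'_def]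
    norm_num [Finset.sum_range_succ, Nat.choose, h5, h6, h7, h8, h9, h10, h11]
  have h14 : bernoulli' 14 = 7/6 := by
    rw [bernoulli'_def]
    norm_num [Finset.sum_range_succ, Nat.choose, h5, h6, h7, h8, h9, h10, h11, h12, h13]
  refine ⟨?_, ?_, ?_, ?_, ?_⟩ <;> rw [bernoulli_eq_bernoulli'_of_ne_one (by norm_num)]
  · simp
  all_goals assumption

lemma exists_E4 : ∃ s : PowerSeries ℤ, PowerSeries.constantCoeff s = 0 ∧
    ∀ z : ℂ, 0 < z.im → HS (PowerSeries.map (Int.castRingHom ℂ) (1 + 240 * s)) (qexp z) (Eis 4 z) := by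
  refine ⟨PowerSeries.mk fun n => if n = 0 then 0 else ((ArithmeticFunction.sigma (4 - 1) n : ℕ) : ℤ), ?_, ?_⟩
  · rw [← PowerSeries.coeff_zero_eq_constantCoeff_apply]
    simp
  · intro z hz
    have := HS_Eis (k := 4) (by norm_num) (by decide) 240
      (by rw [bern_vals.1]; norm_num) hz
    exact_mod_cast this

lemma exists_Ek (k' : ℕ)
    (hk' : k' = 0 ∨ k' = 4 ∨ k' = 6 ∨ k' = 8 ∨ k' = 10 ∨ k' = 14) :
    ∃ e : PowerSeries ℤ, PowerSeries.constantCoeff e = 1 ∧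
    ∀ z : ℂ, 0 < z.im → HS (PowerSeries.map (Int.castRingHom ℂ) e) (qexp z) (Eis k' z) := by
  obtain ⟨h4, h6, h8, h10, h14⟩ := bern_vals
  have gen : ∀ k : ℕ, 3 ≤ k → Even k → ∀ c : ℤ, -(2 * k / _root_.bernoulli k : ℚ) = c →
      ∃ e : PowerSeries ℤ, PowerSeries.constantCoeff e = 1 ∧
      ∀ z : ℂ, 0 < z.im → HS (PowerSeries.map (Int.castRingHom ℂ) e) (qexp z) (Eis k z) := by
    intro k hk hk2 c hc
    refine ⟨_, ?_, fun z hz => HS_Eis hk hk2 c hc hz⟩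
    rw [← PowerSeries.coeff_zero_eq_constantCoeff_apply]
    simp
  rcases hk' with rfl | rfl | rfl | rfl | rfl | rfl
  · refine ⟨1, by simp, fun z hz => ?_⟩
    simpa [Eis] using HS.one (qexp z)
  · exact gen 4 (by norm_num) (by decide) 240 (by rw [h4]; norm_num)
  · exact gen 6 (by norm_num) (by decide) (-504) (by rw [h6]; norm_num)
  · exact gen 8 (by norm_num) (by decide) 480 (by rw [h8]; norm_num)
  · exact gen 10 (by norm_num) (by decide) (-264) (by rw [h10]; norm_num)
  · exact gen 14 (by norm_num) (by decide) (-24) (by rw [h14]; norm_num)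

end AnalyticPart

/-- For each `n ≥ 1` and `k' ∈ {0,4,6,8,10,14}` there is a
polynomial `P_{n,k'}(X,Y)` with integer coefficients such that for all `ℓ ≥ 1`,
`0 ≤ m ≤ ℓ` with `n ≤ ℓ - m`, the sum of the `n`-th powers of the zeros (with
multiplicity) of the Faber polynomial `F_{12ℓ+k',m}` equals `P_{n,k'}(12ℓ+k', m)`. -/
theorem power_sum_is_integer_polynomial (n k' : ℕ) (hn : 1 ≤ n)
    (hk' : k' = 0 ∨ k' = 4 ∨ k' = 6 ∨ k' = 8 ∨ k' = 10 ∨ k' = 14) :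
    ∃ P : MvPolynomial (Fin 2) ℤ,
      ∀ ℓ m : ℕ, 1 ≤ ℓ → m ≤ ℓ → n ≤ ℓ - m →
        ∀ (f : ℂ → ℂ) (F : Polynomial ℂ),
          IsMillerForm ℓ k' m f → IsFaber ℓ k' m f F →
            powerSumRoots F n
              = MvPolynomial.aeval ![((12 * ℓ + k' : ℕ) : ℂ), (m : ℂ)] P := by
  obtain ⟨s, hs, hE4⟩ := exists_E4
  obtain ⟨e, he, hEk⟩ := exists_Ek k' hk'
  obtain ⟨P, hP⟩ := formal_main (PowerSeries.pentagonalSeries ℤ ^ 24) e s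
    (by rw [map_pow, pent_const, one_pow]) he hs k' n hn
  refine ⟨P, fun ℓ m _ hm hnm f F hf hF => ?_⟩
  obtain ⟨-, -, -, a, ha, had⟩ := hf
  obtain ⟨hmon, hdeg, hFf⟩ := hF
  have hsplit : F.Splits := IsAlgClosed.splits F
  have hcard : F.roots.card = ℓ - m := by
    rw [← hdeg]
    exact hsplit.natDegree_eq_card_roots.symm
  set φ := PowerSeries.map (Int.castRingHom ℂ) with hφ
  set d := PowerSeries.pentagonalSeries ℤ ^ 24 with hd
  have hval : ∀ z : ℂ, 0 < z.im → f z = Disc z ^ m * Eis k' z *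
      (F.roots.map (fun x => Eis 4 z ^ 3 - x * Disc z)).prod := by
    intro z hz
    have hD := Disc_ne_zero hz
    rw [hFf z hz]
    have h1 : F.eval (jinv z) = (F.roots.map (fun x => jinv z - x)).prod := by
      conv_lhs => rw [hsplit.eq_prod_roots_of_monic hmon]
      rw [Polynomial.eval_multiset_prod, Multiset.map_map]
      simp
    have h2 : (F.roots.map (fun x => Eis 4 z ^ 3 - x * Disc z)).prod
        = Disc z ^ (ℓ - m) * (F.roots.map (fun x => jinv z - x)).prod := by
      rw [← hcard, ← Multiset.prod_replicate (F.roots.card), ← Multiset.map_const', ← Multiset.prod_map_mul]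
      congr 1
      refine Multiset.map_congr rfl fun x _ => ?_
      unfold jinv
      field_simp
    rw [h1, h2]
    have h3 : Disc z ^ ℓ = Disc z ^ m * Disc z ^ (ℓ - m) := by
      rw [← pow_add]
      congr 1
      omega
    rw [h3]
    ring
  have hser : PowerSeries.mk a = (PowerSeries.X * φ d) ^ m * φ e *
      (F.roots.map (fun x => φ (1 + 240 * s) ^ 3
        - PowerSeries.C x * (PowerSeries.X * φ d))).prod := by
    refine HS.unique (g := f) (fun z hz => ?_) (fun z hz => ?_)
    · unfold HS
      rw [(ha z hz).2]
      simpa using (ha z hz).1.hasSum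
    · rw [hval z hz]
      exact (((HS_disc hz).pow m).mul (hEk z hz)).mul
        (HS.multiset_prod _ _ _ _ fun x => ((hE4 z hz).pow 3).sub ((HS.C x _).mul (HS_disc hz)))
  have hA : PowerSeries.mk a = PowerSeries.X ^ m *
      (1 + PowerSeries.X ^ (ℓ - m + 1) * PowerSeries.mk (fun i => a (i + (ℓ + 1)))) := by
    have h1 : PowerSeries.X ^ m *
      (1 + PowerSeries.X ^ (ℓ - m + 1) * PowerSeries.mk (fun i => a (i + (ℓ + 1))))
      = PowerSeries.X ^ m + PowerSeries.X ^ (ℓ + 1) * PowerSeries.mk (fun i => a (i + (ℓ + 1))) := by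
      rw [mul_add, mul_one, ← mul_assoc, ← pow_add]
      rw [show m + (ℓ - m + 1) = ℓ + 1 by omega]
    rw [h1]
    ext i
    rw [map_add, PowerSeries.coeff_mk, PowerSeries.coeff_X_pow, PowerSeries.coeff_X_pow_mul']
    by_cases hi : i ≤ ℓ
    · rw [had i hi, if_neg (show ¬ (ℓ + 1 ≤ i) by omega), add_zero]
    · rw [if_neg (show ¬ i = m by omega), if_pos (show ℓ + 1 ≤ i by omega), zero_add,
        PowerSeries.coeff_mk]
      congr 1
      omega
  refine hP ℓ m hm hnm F.roots (PowerSeries.mk (fun i => a (i + (ℓ + 1)))) hcard ?_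
  have hX : (PowerSeries.X : PowerSeries ℂ) ^ m ≠ 0 := pow_ne_zero _ PowerSeries.X_ne_zero
  apply mul_left_cancel₀ hX
  rw [← hA, hser, mul_pow]
  ring
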